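/- Assume the continuum hypothesis, 2^{ℵ0} = ℵ1. Then for every compact Hausdorff scattered topological space X, the set {α < hgt(X) : |I(X^(α))| = ℵ0} has cardinality at most ℵ1. -/

import Mathlib

open Set

/-- The set of points of `A` that are isolated in the subspace `A`. -/
def isolatedIn {X : Type*} [TopologicalSpace X] (A : Set X) : Set X :=
  {x | x ∈ A ∧ ∃ U : Set X, IsOpen U ∧ U ∩ A = {x}}

/-- A space is scattered iff every nonempty subset has a point isolated in it. -/
def Scattered (X : Type*) [TopologicalSpace X] : Prop :=
  ∀ A : Set X, A.Nonempty → (isolatedIn A).Nonempty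

/-- `piece K b` is `K` if `b = false` and the complement of `K` if `b = true`. -/
def piece {D : Type*} (K : Set D) (b : Bool) : Set D := if b then Kᶜ else K

/-- Independence for an `ω`-sequence of subsets. -/
def IndepSeq {D : Type*} (K : ℕ → Set D) : Prop :=
  ∀ (n : ℕ) (s : Fin n → Bool), (⋂ i : Fin n, piece (K i) (s i)).Nonempty

/-- Independence for a finite sequence of subsets. -/
def IndepFin {D : Type*} {n : ℕ} (K : Fin n → Set D) : Prop :=
  ∀ (m : ℕ) (hm : m ≤ n) (s : Fin m → Bool),
    (⋂ i : Fin m, piece (K (Fin.castLE hm i)) (s i)).Nonempty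

/-- Independence for a list of subsets. -/
def IndepList {D : Type*} (L : List (Set D)) : Prop :=
  IndepFin (fun i : Fin L.length => L.get i)

/-- A subalgebra of the power set: contains the whole set and is closed under
complements and finite unions. -/
def IsSubalgebra {D : Type*} (A : Set (Set D)) : Prop :=
  Set.univ ∈ A ∧ (∀ s ∈ A, sᶜ ∈ A) ∧ (∀ s ∈ A, ∀ t ∈ A, s ∪ t ∈ A)

/-- `A` separates the points of `E`. -/
def SeparatesPts {D : Type*} (A : Set (Set D)) (E : Set D) : Prop :=
  ∀ a ∈ E, ∀ b ∈ E, a ≠ b → ∃ H ∈ A, a ∈ H ∧ b ∉ H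

/-- Nodes of the tree `T(⟨C ξ : ξ < γ⟩)`. -/
structure TNode (D : Type*) (γ : Ordinal) (C : Ordinal → Set (Set D)) where
  xs : List Ordinal
  hs : List (Set D)
  len_eq : xs.length = hs.length
  nodup : xs.Nodup
  lt : ∀ ξ ∈ xs, ξ < γ
  mem : ∀ i : Fin xs.length, hs.get (Fin.cast len_eq i) ∈ C (xs.get i)
  indep : IndepList hs

/-- `TExt y x` : `y` is a proper extension of `x` in the tree (so `y` lies
strictly below `x`, the root `(∅,∅)` being the top). -/
def TExt {D : Type*} {γ : Ordinal} {C : Ordinal → Set (Set D)}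
    (y x : TNode D γ C) : Prop :=
  x.xs <+: y.xs ∧ x.hs <+: y.hs ∧ x.xs.length < y.xs.length

/-- Ordinal–indexed Cantor–Bendixson derivatives. -/
noncomputable def CBD (X : Type*) [TopologicalSpace X] : Ordinal → Set X := fun o =>
  o.limitRecOn Set.univ (fun _ S => S \ isolatedIn S)
    (fun o _ ih => ⋂ p : {o' : Ordinal // o' < o}, ih p p.2)

/-- The Cantor–Bendixson height: the least `α` with `CBD X α = ∅`. -/
noncomputable def hgt (X : Type*) [TopologicalSpace X] : Ordinal :=
  sInf {α : Ordinal | CBD X α = ∅}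

universe u

section CantorBendixson

variable {X : Type*} [TopologicalSpace X]

theorem CBD_add_one (o : Ordinal) : CBD X (o + 1) = CBD X o \ isolatedIn (CBD X o) :=
  Ordinal.limitRecOn_add_one ..

theorem CBD_limit {o : Ordinal} (ho : Order.IsSuccLimit o) :
    CBD X o = ⋂ p : {o' : Ordinal // o' < o}, CBD X p :=
  Ordinal.limitRecOn_limit _ _ _ _ ho

theorem CBD_antitone : Antitone (CBD X) := by
  intro a b
  induction b using Ordinal.limitRecOn with
  | zero => intro h; rw [nonpos_iff_eq_zero.mp h]
  | add_one b ih =>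
    intro h
    rcases h.eq_or_lt with rfl | h
    · exact le_rfl
    · rw [CBD_add_one]
      exact sdiff_subset.trans (ih (Order.lt_add_one_iff.mp h))
  | limit b hb _ =>
    intro h
    rcases h.eq_or_lt with rfl | h
    · exact le_rfl
    · rw [CBD_limit hb]
      exact iInter_subset (fun p : {o' : Ordinal // o' < b} => CBD X p) ⟨a, h⟩

theorem CBD_nonempty_of_lt_hgt {o : Ordinal} (ho : o < hgt X) : (CBD X o).Nonempty :=
  nonempty_iff_ne_empty.mpr fun h => ho.not_ge (csInf_le' h)

theorem Scattered.subset_closure_isolatedIn (hX : Scattered X) (A : Set X) :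
    A ⊆ closure (isolatedIn A) := by
  intro x hx
  rw [mem_closure_iff]
  intro U hU hxU
  obtain ⟨y, hy, W, hW, hWy⟩ := hX (U ∩ A) ⟨x, hxU, hx⟩
  exact ⟨y, hy.1, hy.2, W ∩ U, hW.inter hU, by rw [inter_assoc, hWy]⟩

/-- In a regular space, an isolated point of `A` has an open neighbourhood whose closure meets `A`
only in that point. -/
theorem exists_isOpen_closure_inter_subset [RegularSpace X] {A : Set X} {x : X}
    (hx : x ∈ isolatedIn A) :
    ∃ V : Set X, IsOpen V ∧ x ∈ V ∧ closure V ∩ A ⊆ {x} := by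
  obtain ⟨-, U, hU, hUx⟩ := hx
  have hxU : x ∈ U := (hUx.symm.subset rfl).1
  obtain ⟨t, ht, htc, htU⟩ := exists_mem_nhds_isClosed_subset (hU.mem_nhds hxU)
  exact ⟨interior t, isOpen_interior, mem_interior_iff_mem_nhds.mpr ht, hUx ▸
    inter_subset_inter_left A ((closure_minimal interior_subset htc).trans htU)⟩

/-- In a regular scattered space, the levels from `o` on inject into the power set of the
level `o`. -/
theorem Scattered.exists_injective_levels [RegularSpace X] (hX : Scattered X) (o : Ordinal) :
    ∃ f : {b : Ordinal // o ≤ b ∧ b < hgt X} → Set (isolatedIn (CBD X o)),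
      Function.Injective f := by
  choose x hx using fun b : {b : Ordinal // o ≤ b ∧ b < hgt X} =>
    hX _ (CBD_nonempty_of_lt_hgt b.2.2)
  choose V hVo hxV hV using fun b => exists_isOpen_closure_inter_subset (hx b)
  refine ⟨fun b => Subtype.val ⁻¹' V b, Function.Injective.of_lt_imp_ne fun b c hbc h => ?_⟩
  have hc : x c ∈ closure (V b) := by
    have hmem := (hVo c).inter_closure ⟨hxV c,
      hX.subset_closure_isolatedIn _ (CBD_antitone c.2.1 (hx c).1)⟩
    refine closure_mono ?_ hmem
    rintro y ⟨hyc, hy⟩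
    exact (Set.ext_iff.mp h ⟨y, hy⟩).mpr hyc
  have hsucc : x c ∈ CBD X b \ isolatedIn (CBD X b) :=
    CBD_add_one (X := X) b ▸ CBD_antitone (Order.add_one_le_of_lt hbc) (hx c).1
  exact hsucc.2 ((hV b ⟨hc, hsucc.1⟩ : x c = x b) ▸ hx b)

end CantorBendixson

/-- under CH, for every compact Hausdorff scattered space the set
of levels α < hgt X with |I(X^(α))| = ℵ₀ has cardinality at most ℵ₁. -/
theorem stmt_19 {X : Type u} [TopologicalSpace X] [CompactSpace X] [T2Space X]
    (CH : Cardinal.continuum.{u} = Cardinal.aleph 1)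
    (hX : Scattered X) :
    Cardinal.mk {α : Ordinal.{u} //
        α < hgt X ∧ Cardinal.mk (isolatedIn (CBD X α)) = Cardinal.aleph0} ≤
      Cardinal.aleph 1 := by
  set S : Set Ordinal.{u} :=
    {α | α < hgt X ∧ Cardinal.mk (isolatedIn (CBD X α)) = Cardinal.aleph0}
  change Cardinal.mk S ≤ _
  rcases S.eq_empty_or_nonempty with hS | hS
  · simp [hS]
  have hmin : sInf S ∈ S := csInf_mem hS
  obtain ⟨f, hf⟩ := hX.exists_injective_levels (sInf S)
  have hg : Function.Injective fun b : S => f ⟨b, csInf_le' b.2, b.2.1⟩ := fun b c h =>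
    Subtype.ext (Subtype.mk.inj (hf h))
  have hcard := Cardinal.mk_le_of_injective
    (Equiv.ulift.{u + 1}.symm.injective.comp hg)
  rwa [Cardinal.mk_uLift, Cardinal.mk_set, hmin.2, Cardinal.two_power_aleph0, CH,
    Cardinal.lift_aleph, Ordinal.lift_one] at hcard
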